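/- Let V be a Henselian valuation ring with fraction field K, let K'/K be a finite separable field extension, and let f ∈ K' be a nonzero element whose norm Nm_{K'/K}(f) lies in V. Then f is integral over V. -/

import Mathlib

open Polynomial IsLocalRing
open scoped Pointwise

section InvariantAction

variable {B G : Type*} [CommRing B] [Group G] [Finite G] [MulSemiringAction G B]

/-- For a maximal ideal `M` of a ring acted on by a finite group, there is an element fixed by the
stabilizer of `M`, congruent to `1` modulo `M`, all of whose other conjugates lie in `M`. -/
theorem Ideal.IsMaximal.exists_smul_eq_self_and_smul_mem (M : Ideal B) [hM : M.IsMaximal] :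
    ∃ b : B, b - 1 ∈ M ∧ (∀ g : G, g • M = M → g • b = b) ∧
      ∀ g : G, g • M ≠ M → g • b ∈ M := by
  classical
  cases nonempty_fintype G
  have hprime := hM.isPrime
  obtain ⟨c, hcM, hc⟩ : ∃ c : B, c - 1 ∈ M ∧ ∀ g : G, g • M ≠ M → c ∈ g • M := by
    have hI : ¬ ∏ g : G with g • M ≠ M, g • M ≤ M := by
      rw [Ideal.IsPrime.prod_le hprime]
      rintro ⟨g, hg, hle⟩
      have hgM : (g • M).IsMaximal := by
        rw [Ideal.pointwise_smul_eq_comap]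
        exact Ideal.comap_isMaximal_of_equiv _
      exact (Finset.mem_filter.mp hg).2 (hgM.eq_of_le hM.ne_top hle)
    obtain ⟨x, hx, hxM⟩ := SetLike.not_le_iff_exists.mp hI
    obtain ⟨y, i, hi, hyx⟩ := hM.exists_inv hxM
    refine ⟨y * x, ?_, fun g hg ↦ ?_⟩
    · rw [← hyx, sub_add_cancel_left]
      exact M.neg_mem hi
    · refine Ideal.mul_mem_left _ _ (Ideal.le_of_dvd ?_ hx)
      exact Finset.dvd_prod_of_mem _ (by simpa using hg)
  refine ⟨∏ h : MulAction.stabilizer G M, h • c, ?_, fun g hg ↦ ?_, fun g hg ↦ ?_⟩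
  · rw [← Ideal.Quotient.mk_eq_mk_iff_sub_mem, map_prod, map_one]
    refine Finset.prod_eq_one fun h _ ↦ ?_
    rw [← map_one (Ideal.Quotient.mk M), Ideal.Quotient.mk_eq_mk_iff_sub_mem]
    have := Ideal.smul_mem_pointwise_smul (h : G) _ _ hcM
    rwa [smul_sub, smul_one, h.2] at this
  · exact Finset.smul_prod_perm c (⟨g, hg⟩ : MulAction.stabilizer G M)
  · rw [Finset.smul_prod']
    refine M.mem_of_dvd (Finset.dvd_prod_of_mem _ (Finset.mem_univ 1)) ?_
    rw [one_smul, ← Ideal.mem_inv_pointwise_smul_iff]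
    exact hc _ fun h ↦ hg (by rw [inv_smul_eq_iff] at h; exact h.symm)

/-- A domain with a finite group action whose ring of invariants is a Henselian local ring
is local. -/
theorem HenselianLocalRing.isLocalRing_of_isInvariant (V G : Type*) [Group G] [Finite G]
    [MulSemiringAction G B] [CommRing V] [HenselianLocalRing V] [IsDomain B] [Algebra V B]
    [SMulCommClass G V B] [Algebra.IsInvariant V B G] :
    IsLocalRing B := by
  classical
  cases nonempty_fintype G
  have : Algebra.IsIntegral V B := Algebra.IsInvariant.isIntegral V B G
  have under_eq (M : Ideal B) (hM : M.IsMaximal) : M.under V = maximalIdeal V :=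
    eq_maximalIdeal (Ideal.isMaximal_comap_of_isIntegral_of_isMaximal M)
  obtain ⟨M, hM⟩ := Ideal.exists_maximal B
  refine .of_unique_max_ideal ⟨M, hM, fun N hN ↦ ?_⟩
  have mem_M (a : V) : algebraMap V B a ∈ M ↔ a ∈ maximalIdeal V := by
    rw [← under_eq M hM]; rfl
  have mem_N (a : V) : algebraMap V B a ∈ N ↔ a ∈ maximalIdeal V := by
    rw [← under_eq N hN]; rfl
  by_contra hne
  obtain ⟨b, hb1, hbfix, hbmem⟩ := Ideal.IsMaximal.exists_smul_eq_self_and_smul_mem (G := G) M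
  have hbN : b ∈ N := by
    obtain ⟨g, rfl⟩ := Algebra.IsInvariant.exists_smul_of_under_eq V B G M N
      ((under_eq M hM).trans (under_eq N hN).symm)
    rw [Ideal.mem_pointwise_smul_iff_inv_smul_mem]
    exact hbmem _ fun h ↦ hne (by rw [inv_smul_eq_iff] at h; exact h.symm)
  let S : Finset B := Finset.univ.image fun g : G ↦ g • b
  have hbS : b ∈ S := Finset.mem_image.mpr ⟨1, Finset.mem_univ _, one_smul _ _⟩
  have hS (y : B) (hy : y ∈ S) (hyb : y ≠ b) : y ∈ M := by
    obtain ⟨g, -, rfl⟩ := Finset.mem_image.mp hy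
    exact hbmem g fun h ↦ hyb (hbfix g h)
  let P : B[X] := ∏ y ∈ S, (X - C y)
  have hPlift : P ∈ lifts (algebraMap V B) := by
    refine P.lifts_iff_coeff_lifts.mpr fun n ↦
      Algebra.IsInvariant.isInvariant (G := G) _ fun g ↦ ?_
    rw [← coeff_smul]
    congr 1
    simp only [P, Finset.smul_prod', smul_sub, smul_X, smul_C]
    refine Finset.prod_bijective (g • ·) (MulAction.bijective g) (fun y ↦ ?_) fun _ _ ↦ rfl
    simp only [S, Finset.mem_image, Finset.mem_univ, true_and]
    constructor
    · rintro ⟨h, rfl⟩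
      exact ⟨g * h, mul_smul _ _ _⟩
    · rintro ⟨h, hh⟩
      exact ⟨g⁻¹ * h, by rw [mul_smul, hh, inv_smul_smul]⟩
  obtain ⟨Q, hQP, -, hQ⟩ := lifts_and_natDegree_eq_and_monic hPlift
    (monic_prod_of_monic _ _ fun y _ ↦ monic_X_sub_C y)
  let R : B[X] := ∏ y ∈ S.erase b, (X - C y)
  have hPR : P = (X - C b) * R := (Finset.mul_prod_erase S _ hbS).symm
  have hb1' : 1 - b ∈ M := by rw [← neg_sub]; exact M.neg_mem hb1
  have eval_map_one (q : V[X]) : algebraMap V B (q.eval 1) = (q.map (algebraMap V B)).eval 1 := by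
    rw [eval_one_map]
  have hR : R.eval 1 ∉ M := by
    simp only [R, eval_prod, eval_sub, eval_X, eval_C]
    rw [hM.isPrime.prod_mem_iff]
    rintro ⟨y, hy, hyM⟩
    rw [Finset.mem_erase] at hy
    exact hM.ne_top (M.eq_top_iff_one.mpr (by simpa using M.add_mem hyM (hS y hy.2 hy.1)))
  obtain ⟨a, ha, ha1⟩ := HenselianLocalRing.is_henselian Q hQ 1
    (by
      rw [← mem_M, eval_map_one, hQP, hPR]
      simpa using M.mul_mem_right _ hb1')
    (by
      rw [← not_not (a := IsUnit _), ← mem_nonunits_iff, ← mem_maximalIdeal, ← mem_M,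
        eval_map_one, ← derivative_map, hQP, hPR]
      simpa [derivative_mul] using fun h ↦ hR ((M.add_mem_iff_left (M.mul_mem_right _ hb1')).mp h))
  have haP : P.eval (algebraMap V B a) = 0 := by
    rw [← hQP, eval_map_algebraMap, aeval_algebraMap_apply, coe_aeval_eq_eval, ha, map_zero]
  have hab : algebraMap V B a = b := by
    simp only [P, eval_prod, eval_sub, eval_X, eval_C, Finset.prod_eq_zero_iff] at haP
    obtain ⟨y, hy, hay⟩ := haP
    rw [sub_eq_zero] at hay
    by_contra hne
    have haM := (mem_M a).mp (hay ▸ hS y hy (hay ▸ hne))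
    exact (maximalIdeal.isMaximal V).ne_top
      ((Ideal.eq_top_iff_one _).mpr (by simpa using Ideal.sub_mem _ haM ha1))
  have haN := (mem_N a).mp (hab ▸ hbN)
  exact (maximalIdeal.isMaximal V).ne_top
    ((Ideal.eq_top_iff_one _).mpr (by simpa using Ideal.sub_mem _ haN ha1))

end InvariantAction

section IntegralClosure

variable {V L : Type*} [CommRing V] [Field L] [Algebra V L]

theorem isIntegral_of_forall_mem_valuationSubring {y : L}
    (h : ∀ W : ValuationSubring L, (∀ a : V, algebraMap V L a ∈ W) → y ∈ W) :
    IsIntegral V y := by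
  by_contra hy
  obtain ⟨W, hW, hyW⟩ := Subring.exists_le_valuationSubring_of_isIntegrallyClosedIn
    (R := (integralClosure V L).toSubring) (x := y) hy
  exact hyW (h W fun a ↦ hW ((integralClosure V L).algebraMap_mem a))

/-- If `P(x) = 0`, the tails `aₙ xⁿ⁻ʲ + ⋯ + aⱼ` of `P` at `x` are integral. -/
theorem isIntegral_aeval_iterate_divX {P : V[X]} {x : L} (hx : aeval x P = 0) (j : ℕ) :
    IsIntegral V (aeval x (divX^[j] P)) := by
  refine isIntegral_of_forall_mem_valuationSubring fun W hW ↦ ?_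
  by_cases hxW : x ∈ W
  · rw [aeval_eq_sum_range]
    refine sum_mem fun i _ ↦ ?_
    rw [Algebra.smul_def]
    exact mul_mem (hW _) (pow_mem hxW i)
  · have hx0 : x ≠ 0 := fun h ↦ hxW (h ▸ W.zero_mem)
    replace hxW := (W.mem_or_inv_mem x).resolve_left hxW
    induction j with
    | zero => simp [hx]
    | succ j ih =>
      rw [Function.iterate_succ_apply']
      set q := divX^[j] P
      have hq : aeval x q.divX = x⁻¹ * (aeval x q - algebraMap V L (q.coeff 0)) := by
        conv_rhs => rw [← divX_mul_X_add q]
        simp [field]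
      rw [hq]
      exact mul_mem hxW (sub_mem ih (hW _))

theorem isIntegral_or_isIntegral_inv_of_aeval_eq_zero [IsLocalRing (integralClosure V L)]
    {P : V[X]} {x : L} (hx : aeval x P = 0) {k : ℕ} (hk : P.coeff k = 1) :
    IsIntegral V x ∨ IsIntegral V x⁻¹ := by
  let t (j : ℕ) : L := aeval x (divX^[j] P)
  have ht (j : ℕ) : IsIntegral V (t j) := isIntegral_aeval_iterate_divX hx j
  have coeff_iterate (j i : ℕ) : (divX^[j] P).coeff i = P.coeff (i + j) := by
    induction j generalizing i with
    | zero => rfl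
    | succ j ih => rw [Function.iterate_succ_apply', coeff_divX, ih]; congr 1; ring
  have hrec (j : ℕ) : t (j + 1) * x = t j - algebraMap V L (P.coeff j) := by
    have h := congrArg (aeval x) (divX_mul_X_add (divX^[j] P))
    rw [coeff_iterate, zero_add] at h
    simp only [t, Function.iterate_succ_apply', ← h]
    simp
  have htx (j : ℕ) : IsIntegral V (t (j + 1) * x) := by
    rw [hrec]
    exact (ht j).sub isIntegral_algebraMap
  have inv_of_isUnit (y : integralClosure V L) (hy : IsUnit y) : IsIntegral V (y : L)⁻¹ := by
    obtain ⟨z, hz⟩ := hy.exists_right_inv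
    rw [inv_eq_of_mul_eq_one_right (b := (z : L)) (congrArg Subtype.val hz)]
    exact z.2
  have hsum : (⟨t k, ht k⟩ : integralClosure V L) + -⟨t (k + 1) * x, htx k⟩ = 1 := by
    apply Subtype.ext
    simp [hrec, hk]
  rcases IsLocalRing.isUnit_or_isUnit_of_add_one hsum with h | h
  · left
    have h0 : t k ≠ 0 := fun h0 ↦ h.ne_zero (Subtype.ext h0)
    obtain _ | j := k
    · exact absurd hx h0
    · simpa [h0] using (inv_of_isUnit _ h).mul (htx j)
  · right
    rw [IsUnit.neg_iff] at h
    have h0 : t (k + 1) ≠ 0 := fun h0 ↦ h.ne_zero (Subtype.ext (by simp [h0]))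
    have := (ht (k + 1)).mul (inv_of_isUnit _ h)
    rwa [mul_inv, mul_inv_cancel_left₀ h0] at this

end IntegralClosure

section Valuation

variable {V : Type*} [CommRing V] [IsDomain V] [ValuationRing V]

/-- Over a valuation ring, every nonzero polynomial over the fraction field can be rescaled to an
integral polynomial with a coefficient equal to `1`. -/
theorem ValuationRing.exists_map_eq_C_mul (K : Type*) [Field K] [Algebra V K] [IsFractionRing V K]
    {p : K[X]} (hp : p ≠ 0) :
    ∃ (P : V[X]) (c : K) (k : ℕ), P.map (algebraMap V K) = C c * p ∧ P.coeff k = 1 := by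
  obtain ⟨k, hk, hmax⟩ := Finset.exists_max_image p.support
    (fun i ↦ ValuationRing.valuation V K (p.coeff i)) (nonempty_support_iff.mpr hp)
  have hk0 : p.coeff k ≠ 0 := mem_support_iff.mp hk
  have hlift : C (p.coeff k)⁻¹ * p ∈ lifts (algebraMap V K) := by
    refine (lifts_iff_coeff_lifts _).mpr fun n ↦ ?_
    rw [coeff_C_mul]
    refine (ValuationRing.mem_integer_iff V K _).mp ?_
    rw [Valuation.mem_integer_iff, map_mul, map_inv₀]
    by_cases hn : n ∈ p.support
    · exact inv_mul_le_one_of_le₀ (hmax n hn) zero_le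
    · simp [notMem_support_iff.mp hn]
  obtain ⟨P, hP⟩ := (mem_lifts _).mp hlift
  refine ⟨P, (p.coeff k)⁻¹, k, hP, IsFractionRing.injective V K ?_⟩
  rw [← coeff_map, hP, coeff_C_mul, inv_mul_cancel₀ hk0, map_one]

variable [HenselianLocalRing V]

variable (V) in
theorem HenselianLocalRing.isLocalRing_integralClosure (K L : Type*) [Field K] [Algebra V K]
    [IsFractionRing V K] [Field L] [Algebra K L] [FiniteDimensional K L] [IsGalois K L]
    [Algebra V L] [IsScalarTower V K L] :
    IsLocalRing (integralClosure V L) := by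
  have : IsFractionRing (integralClosure V L) L :=
    integralClosure.isFractionRing_of_finite_extension K L
  let := IsIntegralClosure.MulSemiringAction V K L (integralClosure V L)
  have : SMulCommClass Gal(L/K) V (integralClosure V L) :=
    ⟨fun g a b ↦ map_smul (galRestrict V K L (integralClosure V L) g) a b⟩
  have := Algebra.isInvariant_of_isGalois V K L (integralClosure V L)
  exact HenselianLocalRing.isLocalRing_of_isInvariant V Gal(L/K)

theorem HenselianLocalRing.isIntegral_or_isIntegral_inv (K : Type*) {L : Type*} [Field K]
    [Algebra V K] [IsFractionRing V K] [Field L] [Algebra K L] [FiniteDimensional K L]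
    [IsGalois K L] [Algebra V L] [IsScalarTower V K L] (x : L) :
    IsIntegral V x ∨ IsIntegral V x⁻¹ := by
  have := HenselianLocalRing.isLocalRing_integralClosure V K L
  obtain ⟨P, c, k, hP, hk⟩ := ValuationRing.exists_map_eq_C_mul (V := V) K
    (minpoly.ne_zero (Algebra.IsIntegral.isIntegral (R := K) x))
  refine isIntegral_or_isIntegral_inv_of_aeval_eq_zero (P := P) ?_ hk
  rw [← aeval_map_algebraMap K, hP, map_mul, minpoly.aeval, mul_zero]

theorem HenselianLocalRing.isIntegral_of_norm_mem_range {K L : Type*} [Field K] [Algebra V K]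
    [IsFractionRing V K] [Field L] [Algebra K L] [FiniteDimensional K L] [IsGalois K L]
    [Algebra V L] [IsScalarTower V K L] {x : L}
    (hnorm : Algebra.norm K x ∈ (algebraMap V K).range) : IsIntegral V x := by
  classical
  rcases eq_or_ne x 0 with rfl | hx0
  · exact isIntegral_zero
  refine (HenselianLocalRing.isIntegral_or_isIntegral_inv K x).elim id fun hinv ↦ ?_
  obtain ⟨a, ha⟩ := hnorm
  have hprod : algebraMap V L a = x * ∏ σ ∈ Finset.univ.erase (1 : Gal(L/K)), σ x := by
    rw [IsScalarTower.algebraMap_apply V K L, ha, Algebra.norm_eq_prod_automorphisms,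
      ← Finset.mul_prod_erase _ _ (Finset.mem_univ (1 : Gal(L/K)))]
    rfl
  have hne : ∏ σ ∈ Finset.univ.erase (1 : Gal(L/K)), σ x ≠ 0 :=
    Finset.prod_ne_zero_iff.mpr fun σ _ ↦ by simpa using hx0
  have hx : x = algebraMap V L a * ∏ σ ∈ Finset.univ.erase (1 : Gal(L/K)), σ x⁻¹ := by
    simp only [hprod, map_inv₀, Finset.prod_inv_distrib]
    rw [mul_assoc, mul_inv_cancel₀ hne, mul_one]
  rw [hx]
  exact isIntegral_algebraMap.mul (IsIntegral.prod _ fun σ _ ↦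
    hinv.map (σ.toAlgHom.restrictScalars V))

end Valuation

/-- Let `V` be a Henselian valuation ring with fraction field `K`, let `K'/K` be a finite
separable field extension, and let `f ∈ K'` be a nonzero element whose norm
`Nm_{K'/K}(f)` lies in `V`. Then `f` is integral over `V`. -/
theorem stmt_4 {V K K' : Type*} [CommRing V] [IsDomain V] [ValuationRing V]
    [HenselianLocalRing V] [Field K] [Algebra V K] [IsFractionRing V K]
    [Field K'] [Algebra K K'] [FiniteDimensional K K'] [Algebra.IsSeparable K K']
    [Algebra V K'] [IsScalarTower V K K']
    (f : K') (hf : f ≠ 0)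
    (hnorm : Algebra.norm K f ∈ (algebraMap V K).range) :
    IsIntegral V f := by
  let L := IntermediateField.normalClosure K K' (AlgebraicClosure K')
  have (φ : K' →ₐ[K] AlgebraicClosure K') : Algebra.IsSeparable K φ.fieldRange :=
    AlgEquiv.Algebra.isSeparable (AlgEquiv.ofInjectiveField φ)
  have : Algebra.IsSeparable K L := IntermediateField.isSeparable_iSup K _
  have : IsGalois K L := {}
  have : IsScalarTower V K' L := .of_algebraMap_eq fun a ↦
    Subtype.ext (IsScalarTower.algebraMap_apply V K' (AlgebraicClosure K') a)
  rw [← isIntegral_algebraMap_iff (algebraMap K' L).injective]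
  apply HenselianLocalRing.isIntegral_of_norm_mem_range (K := K)
  rw [← Algebra.norm_norm (S := K'), Algebra.norm_algebraMap, map_pow]
  exact pow_mem hnorm _
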